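/- arXiv:1205.6935 — 6 statements merged into one kernel-verified Lean document; each statement's English description precedes it below -/
import Mathlib

section
/- (Data processing inequality for relevant information loss.) Let V, W, X be random variables on a common probability space taking values in finite sets such that V and X are conditionally independent given W (i.e., V–W–X is a Markov chain), and let Y = g(X) for a function g. Then I(X;W|Y) ≥ I(X;V|Y), i.e., L_W(X→Y) ≥ L_V(X→Y). Moreover, I(X;W|Y) = I(X;V|Y) + I(X;W|V,Y). -/
open MeasureTheory ProbabilityTheory Finset

/-- Shannon entropy (in nats) of a random variable `X` taking values in a finite set. -/
noncomputable def entropy {Ω A : Type*} [MeasurableSpace Ω] [Fintype A]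
    (μ : Measure Ω) (X : Ω → A) : ℝ :=
  -∑ a : A, ((μ (X ⁻¹' {a})).toReal * Real.log (μ (X ⁻¹' {a})).toReal)

/-- Conditional Shannon entropy `H(X|Y)` of finite-valued random variables. -/
noncomputable def condEntropy {Ω A B : Type*} [MeasurableSpace Ω] [Fintype A] [Fintype B]
    (μ : Measure Ω) (X : Ω → A) (Y : Ω → B) : ℝ :=
  entropy μ (fun ω => (X ω, Y ω)) - entropy μ Y

/-- Mutual information `I(X;Y)` of finite-valued random variables. -/
noncomputable def mutualInfo {Ω A B : Type*} [MeasurableSpace Ω] [Fintype A] [Fintype B]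
    (μ : Measure Ω) (X : Ω → A) (Y : Ω → B) : ℝ :=
  entropy μ X + entropy μ Y - entropy μ (fun ω => (X ω, Y ω))

/-- Conditional mutual information `I(X;Y|Z)` of finite-valued random variables. -/
noncomputable def condMutualInfo {Ω A B C : Type*} [MeasurableSpace Ω]
    [Fintype A] [Fintype B] [Fintype C]
    (μ : Measure Ω) (X : Ω → A) (Y : Ω → B) (Z : Ω → C) : ℝ :=
  condEntropy μ X Z + condEntropy μ Y Z - condEntropy μ (fun ω => (X ω, Y ω)) Z

lemma dpi_marginal {Ω C : Type*} [MeasurableSpace Ω] [Fintype C] [MeasurableSpace C]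
    [DiscreteMeasurableSpace C] (μ : Measure Ω) [IsProbabilityMeasure μ]
    (Z : Ω → C) (hZ : Measurable Z) (S : Set Ω) :
    μ.real S = ∑ c, μ.real {ω | ω ∈ S ∧ Z ω = c} := by
  have h := sum_measureReal_preimage_singleton (μ := μ.restrict S) (univ : Finset C) (f := Z)
    (fun y _ => hZ (measurableSet_singleton y))
  simp only [coe_univ, Set.preimage_univ, measureReal_restrict_apply MeasurableSet.univ,
    Set.univ_inter] at h
  rw [← h]
  refine Finset.sum_congr rfl fun c _ => ?_
  rw [measureReal_restrict_apply (hZ (measurableSet_singleton c))]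
  congr 1
  ext ω
  simp [and_comm]

lemma dpi_entropy {Ω C A : Type*} [MeasurableSpace Ω] [Fintype C] [MeasurableSpace C]
    [DiscreteMeasurableSpace C] [Fintype A] (μ : Measure Ω) [IsProbabilityMeasure μ]
    (Z : Ω → C) (hZ : Measurable Z) (f : C → A) :
    entropy μ (fun ω => f (Z ω)) =
      -∑ c, μ.real {ω | Z ω = c} * Real.log (μ.real {ω | f (Z ω) = f c}) := by
  classical
  unfold entropy
  congr 1
  rw [← Finset.sum_fiberwise univ f]
  refine Finset.sum_congr rfl fun a _ => ?_
  have e : (μ ((fun ω => f (Z ω)) ⁻¹' {a})).toReal = μ.real {ω | f (Z ω) = a} := rfl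
  rw [e]
  have h2 : ∑ c with f c = a, μ.real {ω | Z ω = c} * Real.log (μ.real {ω | f (Z ω) = f c})
      = ∑ c with f c = a, μ.real {ω | Z ω = c} * Real.log (μ.real {ω | f (Z ω) = a}) := by
    refine Finset.sum_congr rfl fun c hc => ?_
    rw [(Finset.mem_filter.1 hc).2]
  rw [h2, ← Finset.sum_mul]
  congr 1
  rw [dpi_marginal μ Z hZ, Finset.sum_filter]
  refine Finset.sum_congr rfl fun c _ => ?_
  split_ifs with h
  · congr 1
    ext ω
    simp only [Set.mem_ofPred_eq]
    constructor
    · exact fun h => h.2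
    · rintro rfl
      exact ⟨h, rfl⟩
  · have : {ω | ω ∈ {ω | f (Z ω) = a} ∧ Z ω = c} = ∅ := by
      ext ω
      simp only [Set.mem_ofPred_eq, Set.mem_empty_iff_false, iff_false]
      rintro ⟨h1, rfl⟩
      exact h h1
    rw [this]; simp

/-- Data processing inequality for relevant information loss: if `V – W – X`
is a Markov chain (i.e. `V` and `X` are conditionally independent given `W`) and
`Y = g(X)`, then `I(X;W|Y) ≥ I(X;V|Y)`, and moreover
`I(X;W|Y) = I(X;V|Y) + I(X;W|V,Y)`. -/
theorem dpi_relevant_loss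
    {Ω A B D E : Type*} [MeasurableSpace Ω]
    [Fintype A] [MeasurableSpace A] [DiscreteMeasurableSpace A]
    [Fintype B] [MeasurableSpace B] [DiscreteMeasurableSpace B]
    [Fintype D] [MeasurableSpace D] [DiscreteMeasurableSpace D]
    [Fintype E] [MeasurableSpace E] [DiscreteMeasurableSpace E]
    (μ : Measure Ω) [IsProbabilityMeasure μ]
    (X : Ω → A) (V : Ω → D) (W : Ω → E) (g : A → B)
    (hX : Measurable X) (hV : Measurable V) (hW : Measurable W)
    (hMarkov : ∀ (v : D) (w : E) (x : A),
      μ {ω | V ω = v ∧ W ω = w ∧ X ω = x} * μ {ω | W ω = w} =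
        μ {ω | V ω = v ∧ W ω = w} * μ {ω | W ω = w ∧ X ω = x}) :
    condMutualInfo μ X V (fun ω => g (X ω)) ≤ condMutualInfo μ X W (fun ω => g (X ω)) ∧
      condMutualInfo μ X W (fun ω => g (X ω)) =
        condMutualInfo μ X V (fun ω => g (X ω)) +
          condMutualInfo μ X W (fun ω => (V ω, g (X ω))) := by
  classical
  have hZ : Measurable (fun ω => (X ω, V ω, W ω)) := hX.prodMk (hV.prodMk hW)
  -- joint variable is discrete
  set Z : Ω → A × D × E := fun ω => (X ω, V ω, W ω) with hZdef
  have mY : ∀ (v : D) (w : E) (y : B),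
      μ.real {ω | V ω = v ∧ W ω = w ∧ g (X ω) = y} * μ.real {ω | W ω = w} =
        μ.real {ω | V ω = v ∧ W ω = w} * μ.real {ω | W ω = w ∧ g (X ω) = y} := by
    intro v w y
    rw [dpi_marginal μ X hX {ω | V ω = v ∧ W ω = w ∧ g (X ω) = y},
      dpi_marginal μ X hX {ω | W ω = w ∧ g (X ω) = y}, Finset.sum_mul, Finset.mul_sum]
    refine Finset.sum_congr rfl fun x _ => ?_
    by_cases hy : g x = y
    · have h := congrArg ENNReal.toReal (hMarkov v w x)
      rw [ENNReal.toReal_mul, ENNReal.toReal_mul] at h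
      have e1 : {ω | ω ∈ {ω | V ω = v ∧ W ω = w ∧ g (X ω) = y} ∧ X ω = x}
          = {ω | V ω = v ∧ W ω = w ∧ X ω = x} := by
        ext ω; simp only [Set.mem_ofPred_eq]; grind
      have e2 : {ω | ω ∈ {ω | W ω = w ∧ g (X ω) = y} ∧ X ω = x}
          = {ω | W ω = w ∧ X ω = x} := by
        ext ω; simp only [Set.mem_ofPred_eq]; grind
      rw [e1, e2]
      exact h
    · have e1 : {ω | ω ∈ {ω | V ω = v ∧ W ω = w ∧ g (X ω) = y} ∧ X ω = x} = ∅ := by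
        ext ω; simp only [Set.mem_ofPred_eq, Set.mem_empty_iff_false]; grind
      have e2 : {ω | ω ∈ {ω | W ω = w ∧ g (X ω) = y} ∧ X ω = x} = ∅ := by
        ext ω; simp only [Set.mem_ofPred_eq, Set.mem_empty_iff_false]; grind
      rw [e1, e2]; simp
  have mX : ∀ (v : D) (w : E) (x : A),
      μ.real {ω | V ω = v ∧ W ω = w ∧ X ω = x} * μ.real {ω | W ω = w} =
        μ.real {ω | V ω = v ∧ W ω = w} * μ.real {ω | W ω = w ∧ X ω = x} := by
    intro v w x
    have h := congrArg ENNReal.toReal (hMarkov v w x)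
    rw [ENNReal.toReal_mul, ENNReal.toReal_mul] at h
    exact h
  -- entropies
  have hY := dpi_entropy μ Z hZ (fun c => g c.1)
  have hXY := dpi_entropy μ Z hZ (fun c => (c.1, g c.1))
  have hWY := dpi_entropy μ Z hZ (fun c => (c.2.2, g c.1))
  have hVY := dpi_entropy μ Z hZ (fun c => (c.2.1, g c.1))
  have hXWY := dpi_entropy μ Z hZ (fun c => ((c.1, c.2.2), g c.1))
  have hXVY := dpi_entropy μ Z hZ (fun c => ((c.1, c.2.1), g c.1))
  have hXVY' := dpi_entropy μ Z hZ (fun c => (c.1, (c.2.1, g c.1)))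
  have hWVY := dpi_entropy μ Z hZ (fun c => (c.2.2, (c.2.1, g c.1)))
  have hXWVY := dpi_entropy μ Z hZ (fun c => ((c.1, c.2.2), (c.2.1, g c.1)))
  simp only [hZdef, Prod.mk.injEq] at hY hXY hWY hVY hXWY hXVY hXVY' hWVY hXWVY
  -- normal forms of the events
  have s1 : ∀ c : A × D × E, {ω | (X ω = c.1 ∧ W ω = c.2.2) ∧ g (X ω) = g c.1}
      = {ω | W ω = c.2.2 ∧ X ω = c.1} := by
    intro c; ext ω; simp only [Set.mem_ofPred_eq]; grind
  have s2 : ∀ c : A × D × E, {ω | (X ω = c.1 ∧ V ω = c.2.1) ∧ g (X ω) = g c.1}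
      = {ω | X ω = c.1 ∧ V ω = c.2.1} := by
    intro c; ext ω; simp only [Set.mem_ofPred_eq]; grind
  have s3 : ∀ c : A × D × E, {ω | X ω = c.1 ∧ V ω = c.2.1 ∧ g (X ω) = g c.1}
      = {ω | X ω = c.1 ∧ V ω = c.2.1} := by
    intro c; ext ω; simp only [Set.mem_ofPred_eq]; grind
  have s4 : ∀ c : A × D × E, {ω | (X ω = c.1 ∧ W ω = c.2.2) ∧ V ω = c.2.1 ∧ g (X ω) = g c.1}
      = {ω | V ω = c.2.1 ∧ W ω = c.2.2 ∧ X ω = c.1} := by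
    intro c; ext ω; simp only [Set.mem_ofPred_eq]; grind
  have s5 : ∀ c : A × D × E, {ω | W ω = c.2.2 ∧ V ω = c.2.1 ∧ g (X ω) = g c.1}
      = {ω | V ω = c.2.1 ∧ W ω = c.2.2 ∧ g (X ω) = g c.1} := by
    intro c; ext ω; simp only [Set.mem_ofPred_eq]; grind
  have s6 : ∀ c : A × D × E, {ω | (X ω, V ω, W ω) = c}
      = {ω | V ω = c.2.1 ∧ W ω = c.2.2 ∧ X ω = c.1} := by
    intro c; ext ω; simp only [Set.mem_ofPred_eq, Prod.ext_iff]; grind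
  simp only [s1, s2, s3, s4, s5, s6] at hY hXY hWY hVY hXWY hXVY hXVY' hWVY hXWVY
  have pos : ∀ (S T : Set Ω), S ⊆ T → 0 < μ.real S → 0 < μ.real T := fun S T h h0 =>
    lt_of_lt_of_le h0 (measureReal_mono h)
  -- the chain rule identity
  have key : entropy μ (fun ω => (W ω, g (X ω))) - entropy μ (fun ω => ((X ω, W ω), g (X ω)))
      = entropy μ (fun ω => (W ω, (V ω, g (X ω))))
        - entropy μ (fun ω => ((X ω, W ω), (V ω, g (X ω)))) := by
    rw [hWY, hXWY, hWVY, hXWVY]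
    simp only [neg_sub_neg, ← Finset.sum_sub_distrib]
    refine Finset.sum_congr rfl fun c _ => ?_
    rcases (measureReal_nonneg (μ := μ)
      (s := {ω | V ω = c.2.1 ∧ W ω = c.2.2 ∧ X ω = c.1})).eq_or_lt with h0 | h0
    · rw [← h0]; simp
    · rw [← mul_sub, ← mul_sub]
      congr 1
      have p1 := pos _ {ω | V ω = c.2.1 ∧ W ω = c.2.2 ∧ g (X ω) = g c.1}
        (by rintro ω ⟨h1, h2, h3⟩; exact ⟨h1, h2, by rw [h3]⟩) h0
      have p2 := pos _ {ω | W ω = c.2.2} (by rintro ω ⟨h1, h2, h3⟩; exact h2) h0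
      have p3 := pos _ {ω | V ω = c.2.1 ∧ W ω = c.2.2}
        (by rintro ω ⟨h1, h2, h3⟩; exact ⟨h1, h2⟩) h0
      have p4 := pos _ {ω | W ω = c.2.2 ∧ X ω = c.1}
        (by rintro ω ⟨h1, h2, h3⟩; exact ⟨h2, h3⟩) h0
      have p5 := pos _ {ω | W ω = c.2.2 ∧ g (X ω) = g c.1}
        (by rintro ω ⟨h1, h2, h3⟩; exact ⟨h2, by rw [h3]⟩) h0
      have l1 := congrArg Real.log (mX c.2.1 c.2.2 c.1)
      have l2 := congrArg Real.log (mY c.2.1 c.2.2 (g c.1))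
      rw [Real.log_mul h0.ne' p2.ne', Real.log_mul p3.ne' p4.ne'] at l1
      rw [Real.log_mul p1.ne' p2.ne', Real.log_mul p3.ne' p5.ne'] at l2
      linarith
  -- nonnegativity
  have nonneg : 0 ≤ condMutualInfo μ X W (fun ω => (V ω, g (X ω))) := by
    have total : ∑ c : A × D × E, μ.real {ω | V ω = c.2.1 ∧ W ω = c.2.2 ∧ X ω = c.1} = 1 := by
      have h := dpi_marginal μ Z hZ Set.univ
      simp only [Set.mem_univ, true_and, hZdef, s6] at h
      rw [← h]; simp
    have total2 : ∑ a : A, ∑ d : D, μ.real {ω | X ω = a ∧ V ω = d} = 1 := by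
      have h := dpi_marginal μ X hX Set.univ
      rw [probReal_univ] at h
      rw [h]
      refine Finset.sum_congr rfl fun a _ => ?_
      rw [dpi_marginal μ V hV {ω | ω ∈ Set.univ ∧ X ω = a}]
      simp
    have bound : ∑ c : A × D × E, μ.real {ω | X ω = c.1 ∧ V ω = c.2.1} *
        μ.real {ω | V ω = c.2.1 ∧ W ω = c.2.2 ∧ g (X ω) = g c.1} /
          μ.real {ω | V ω = c.2.1 ∧ g (X ω) = g c.1} ≤ 1 := by
      rw [Fintype.sum_prod_type, ← total2]
      refine Finset.sum_le_sum fun a _ => ?_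
      rw [Fintype.sum_prod_type]
      refine Finset.sum_le_sum fun d _ => ?_
      have hm : ∑ w : E, μ.real {ω | V ω = d ∧ W ω = w ∧ g (X ω) = g a}
          = μ.real {ω | V ω = d ∧ g (X ω) = g a} := by
        rw [dpi_marginal μ W hW {ω | V ω = d ∧ g (X ω) = g a}]
        refine Finset.sum_congr rfl fun w _ => ?_
        congr 1; ext ω; simp only [Set.mem_ofPred_eq]; tauto
      dsimp only
      rw [← Finset.sum_div, ← Finset.mul_sum, hm, mul_div_assoc]
      exact mul_le_of_le_one_right measureReal_nonneg (div_self_le_one _)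
    have expand : condMutualInfo μ X W (fun ω => (V ω, g (X ω))) =
        ∑ c : A × D × E, μ.real {ω | V ω = c.2.1 ∧ W ω = c.2.2 ∧ X ω = c.1} *
          (Real.log (μ.real {ω | V ω = c.2.1 ∧ W ω = c.2.2 ∧ X ω = c.1})
            + Real.log (μ.real {ω | V ω = c.2.1 ∧ g (X ω) = g c.1})
            - Real.log (μ.real {ω | X ω = c.1 ∧ V ω = c.2.1})
            - Real.log (μ.real {ω | V ω = c.2.1 ∧ W ω = c.2.2 ∧ g (X ω) = g c.1})) := by
      unfold condMutualInfo condEntropy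
      rw [hXVY', hVY, hWVY, hXWVY]
      simp only [mul_sub, mul_add, Finset.sum_sub_distrib, Finset.sum_add_distrib]
      ring
    rw [expand]
    have : (0:ℝ) ≤ ∑ c : A × D × E, (μ.real {ω | V ω = c.2.1 ∧ W ω = c.2.2 ∧ X ω = c.1} -
        μ.real {ω | X ω = c.1 ∧ V ω = c.2.1} *
        μ.real {ω | V ω = c.2.1 ∧ W ω = c.2.2 ∧ g (X ω) = g c.1} /
          μ.real {ω | V ω = c.2.1 ∧ g (X ω) = g c.1}) := by
      rw [Finset.sum_sub_distrib, total]; linarith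
    refine this.trans (Finset.sum_le_sum fun c _ => ?_)
    rcases (measureReal_nonneg (μ := μ)
      (s := {ω | V ω = c.2.1 ∧ W ω = c.2.2 ∧ X ω = c.1})).eq_or_lt with h0 | h0
    · rw [← h0, zero_mul, zero_sub, neg_nonpos]
      positivity
    · have p1 := pos _ {ω | V ω = c.2.1 ∧ W ω = c.2.2 ∧ g (X ω) = g c.1}
        (by rintro ω ⟨h1, h2, h3⟩; exact ⟨h1, h2, by rw [h3]⟩) h0
      have p2 := pos _ {ω | V ω = c.2.1 ∧ g (X ω) = g c.1}
        (by rintro ω ⟨h1, h2, h3⟩; exact ⟨h1, by rw [h3]⟩) h0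
      have p3 := pos _ {ω | X ω = c.1 ∧ V ω = c.2.1}
        (by rintro ω ⟨h1, h2, h3⟩; exact ⟨h3, h1⟩) h0
      generalize μ.real {ω | V ω = c.2.1 ∧ W ω = c.2.2 ∧ X ω = c.1} = p at *
      generalize μ.real {ω | V ω = c.2.1 ∧ W ω = c.2.2 ∧ g (X ω) = g c.1} = r at *
      generalize μ.real {ω | V ω = c.2.1 ∧ g (X ω) = g c.1} = s at *
      generalize μ.real {ω | X ω = c.1 ∧ V ω = c.2.1} = q at *
      have hl := Real.log_le_sub_one_of_pos (show 0 < q * r / (p * s) by positivity)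
      rw [Real.log_div (by positivity) (by positivity), Real.log_mul p3.ne' p1.ne',
        Real.log_mul h0.ne' p2.ne'] at hl
      have e : p - q * r / s = p * (1 - q * r / (p * s)) := by
        field_simp
      rw [e]
      exact mul_le_mul_of_nonneg_left (by linarith) h0.le
  have main : condMutualInfo μ X W (fun ω => g (X ω)) =
        condMutualInfo μ X V (fun ω => g (X ω)) +
          condMutualInfo μ X W (fun ω => (V ω, g (X ω))) := by
    unfold condMutualInfo condEntropy
    have e : entropy μ (fun ω => ((X ω, V ω), g (X ω)))
      = entropy μ (fun ω => (X ω, (V ω, g (X ω)))) := by rw [hXVY, hXVY']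
    linarith
  exact ⟨by linarith, main⟩
end

section
/- Let X and S be random variables on a common probability space taking values in finite sets, let Y = g(X), and let f be a function on the range of S such that S and X are conditionally independent given f(S) (i.e., S–f(S)–X is a Markov chain). Then the relevant information losses with respect to S and with respect to f(S) coincide: I(X;S|Y) = I(X;f(S)|Y). -/
open MeasureTheory ProbabilityTheory Finset

/-- Entropy of a function of `W`, as a sum over the values of `W`. -/
theorem entropy_comp_eq {Ω E F : Type*} [MeasurableSpace Ω] [Fintype E] [Fintype F]
    (μ : Measure Ω) [IsProbabilityMeasure μ] (W : Ω → E)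
    (hW : ∀ e, MeasurableSet (W ⁻¹' {e})) (h : E → F) :
    entropy μ (fun ω => h (W ω)) =
      -∑ e : E, μ.real (W ⁻¹' {e}) * Real.log (μ.real {ω | h (W ω) = h e}) := by
  classical
  unfold entropy
  congr 1
  rw [← Finset.sum_fiberwise (s := Finset.univ) (g := h)]
  refine Finset.sum_congr rfl fun a _ => ?_
  have h1 : (μ ((fun ω => h (W ω)) ⁻¹' {a})).toReal =
      ∑ e ∈ Finset.univ.filter (fun e => h e = a), μ.real (W ⁻¹' {e}) := by
    rw [← measureReal_biUnion_finset]
    · rw [Measure.real]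
      congr 2
      ext ω
      simp
    · intro i _ j _ hij
      refine Set.disjoint_left.2 fun ω hi hj => hij ?_
      simp at hi hj
      rw [← hi, ← hj]
    · intro e _
      exact hW e
  conv_lhs => arg 1; rw [h1]
  rw [Finset.sum_mul]
  refine Finset.sum_congr rfl fun e he => ?_
  simp only [Finset.mem_filter, Finset.mem_univ, true_and] at he
  subst he
  rfl


/-- If `Y = g(X)` and `S – f(S) – X` is a Markov chain (i.e. `S` and `X` are
conditionally independent given `f(S)`), then `I(X;S|Y) = I(X;f(S)|Y)`. -/
theorem relevant_loss_comp_eq_of_markov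
    {Ω A B C D : Type*} [MeasurableSpace Ω]
    [Fintype A] [MeasurableSpace A] [DiscreteMeasurableSpace A]
    [Fintype B] [MeasurableSpace B] [DiscreteMeasurableSpace B]
    [Fintype C] [MeasurableSpace C] [DiscreteMeasurableSpace C]
    [Fintype D] [MeasurableSpace D] [DiscreteMeasurableSpace D]
    (μ : Measure Ω) [IsProbabilityMeasure μ]
    (X : Ω → A) (S : Ω → C) (g : A → B) (f : C → D)
    (hX : Measurable X) (hS : Measurable S)
    (hMarkov : ∀ (s : C) (t : D) (x : A),
      μ {ω | S ω = s ∧ f (S ω) = t ∧ X ω = x} * μ {ω | f (S ω) = t} =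
        μ {ω | S ω = s ∧ f (S ω) = t} * μ {ω | f (S ω) = t ∧ X ω = x}) :
    condMutualInfo μ X S (fun ω => g (X ω)) =
      condMutualInfo μ X (fun ω => f (S ω)) (fun ω => g (X ω)) := by
  classical
  have hmS : ∀ s, MeasurableSet {ω | S ω = s} := fun s => hS (MeasurableSet.of_discrete (s := {s}))
  have hmX : ∀ x, MeasurableSet {ω | X ω = x} := fun x => hX (MeasurableSet.of_discrete (s := {x}))
  have hW : ∀ e : C × A, MeasurableSet ((fun ω => (S ω, X ω)) ⁻¹' {e}) := by
    rintro ⟨s, x⟩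
    have : ((fun ω => (S ω, X ω)) ⁻¹' {(s, x)}) = {ω | S ω = s} ∩ {ω | X ω = x} := by
      ext ω; simp
    rw [this]
    exact (hmS s).inter (hmX x)
  -- Markov property in real form
  have hM : ∀ (s : C) (x : A),
      μ.real {ω | S ω = s ∧ X ω = x} * μ.real {ω | f (S ω) = f s} =
        μ.real {ω | S ω = s} * μ.real {ω | f (S ω) = f s ∧ X ω = x} := by
    intro s x
    have := congrArg ENNReal.toReal (hMarkov s (f s) x)
    rw [ENNReal.toReal_mul, ENNReal.toReal_mul] at this
    have e1 : {ω | S ω = s ∧ f (S ω) = f s ∧ X ω = x} = {ω | S ω = s ∧ X ω = x} := by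
      ext ω; simp only [Set.mem_ofPred_eq]; grind
    have e2 : {ω | S ω = s ∧ f (S ω) = f s} = {ω | S ω = s} := by
      ext ω; simp only [Set.mem_ofPred_eq]; grind
    rw [e1, e2] at this
    exact this
  have hsum : ∀ (P : Set Ω) (y : B), MeasurableSet P →
      μ.real {ω | ω ∈ P ∧ g (X ω) = y} =
        ∑ x ∈ Finset.univ.filter (fun x => g x = y), μ.real {ω | ω ∈ P ∧ X ω = x} := by
    intro P y hP
    rw [← measureReal_biUnion_finset]
    · congr 1
      ext ω
      simp only [Set.mem_ofPred_eq, Set.mem_iUnion, Finset.mem_filter, Finset.mem_univ, true_and]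
      grind
    · intro i _ j _ hij
      refine Set.disjoint_left.2 fun ω hi hj => hij ?_
      exact hi.2.symm.trans hj.2
    · intro x _
      exact hP.inter (hmX x)
  have hmT : ∀ t, MeasurableSet {ω | f (S ω) = t} := fun t =>
    hS (MeasurableSet.of_discrete (s := {c | f c = t}))
  have hMY : ∀ (s : C) (y : B),
      μ.real {ω | S ω = s ∧ g (X ω) = y} * μ.real {ω | f (S ω) = f s} =
        μ.real {ω | S ω = s} * μ.real {ω | f (S ω) = f s ∧ g (X ω) = y} := by
    intro s y
    have a1 := hsum _ y (hmS s)
    have a2 := hsum _ y (hmT (f s))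
    simp only [Set.mem_ofPred_eq] at a1 a2
    rw [a1, a2, Finset.sum_mul, Finset.mul_sum]
    exact Finset.sum_congr rfl fun x _ => hM s x
  have E1 := entropy_comp_eq μ (fun ω => (S ω, X ω)) hW (fun e => (e.1, g e.2))
  have E2 := entropy_comp_eq μ (fun ω => (S ω, X ω)) hW (fun e => ((e.2, e.1), g e.2))
  have E3 := entropy_comp_eq μ (fun ω => (S ω, X ω)) hW (fun e => (f e.1, g e.2))
  have E4 := entropy_comp_eq μ (fun ω => (S ω, X ω)) hW (fun e => ((e.2, f e.1), g e.2))
  simp only at E1 E2 E3 E4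
  unfold condMutualInfo condEntropy
  rw [E1, E2, E3, E4]
  have key : ∀ e : C × A,
      μ.real ((fun ω => (S ω, X ω)) ⁻¹' {e}) *
          Real.log (μ.real {ω | (S ω, g (X ω)) = (e.1, g e.2)}) -
        μ.real ((fun ω => (S ω, X ω)) ⁻¹' {e}) *
          Real.log (μ.real {ω | ((X ω, S ω), g (X ω)) = ((e.2, e.1), g e.2)}) =
      μ.real ((fun ω => (S ω, X ω)) ⁻¹' {e}) *
          Real.log (μ.real {ω | (f (S ω), g (X ω)) = (f e.1, g e.2)}) -
        μ.real ((fun ω => (S ω, X ω)) ⁻¹' {e}) *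
          Real.log (μ.real {ω | ((X ω, f (S ω)), g (X ω)) = ((e.2, f e.1), g e.2)}) := by
    rintro ⟨s, x⟩
    have r0 : (fun ω => (S ω, X ω)) ⁻¹' {(s, x)} = {ω | S ω = s ∧ X ω = x} := by
      ext ω; simp
    have r1 : {ω | (S ω, g (X ω)) = (s, g x)} = {ω | S ω = s ∧ g (X ω) = g x} := by
      ext ω; simp
    have r2 : {ω | ((X ω, S ω), g (X ω)) = ((x, s), g x)} = {ω | S ω = s ∧ X ω = x} := by
      ext ω; simp only [Set.mem_ofPred_eq, Prod.mk.injEq]; grind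
    have r3 : {ω | (f (S ω), g (X ω)) = (f s, g x)} = {ω | f (S ω) = f s ∧ g (X ω) = g x} := by
      ext ω; simp
    have r4 : {ω | ((X ω, f (S ω)), g (X ω)) = ((x, f s), g x)} =
        {ω | f (S ω) = f s ∧ X ω = x} := by
      ext ω; simp only [Set.mem_ofPred_eq, Prod.mk.injEq]; grind
    simp only [r0, r1, r2, r3, r4]
    rcases (measureReal_nonneg (μ := μ) (s := {ω | S ω = s ∧ X ω = x})).eq_or_lt with h0 | hpos
    · rw [← h0]; simp
    have pos : ∀ Q : Set Ω, {ω | S ω = s ∧ X ω = x} ⊆ Q → μ.real Q ≠ 0 := fun Q hQ =>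
      (hpos.trans_le (measureReal_mono hQ)).ne'
    have p1 := pos {ω | S ω = s ∧ g (X ω) = g x} (fun ω h => ⟨h.1, congrArg g h.2⟩)
    have p2 := pos {ω | f (S ω) = f s} (fun ω h => congrArg f h.1)
    have p3 := pos {ω | S ω = s} (fun ω h => h.1)
    have p4 := pos {ω | f (S ω) = f s ∧ g (X ω) = g x}
      (fun ω h => ⟨congrArg f h.1, congrArg g h.2⟩)
    have p5 := pos {ω | f (S ω) = f s ∧ X ω = x} (fun ω h => ⟨congrArg f h.1, h.2⟩)
    have l1 := congrArg Real.log (hM s x)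
    have l2 := congrArg Real.log (hMY s (g x))
    rw [Real.log_mul hpos.ne' p2, Real.log_mul p3 p5] at l1
    rw [Real.log_mul p1 p2, Real.log_mul p3 p4] at l2
    rw [← mul_sub, ← mul_sub]
    congr 1
    linarith
  have := Finset.sum_congr (rfl : (Finset.univ : Finset (C × A)) = Finset.univ) fun e _ => key e
  rw [Finset.sum_sub_distrib, Finset.sum_sub_distrib] at this
  linarith
end

section
/- (Relevant information loss in a cascade is additive.) Let X and S be random variables on a common probability space taking values in finite sets, let Y = g(X) and Z = h(Y) for functions g and h. Then I(S;X|Z) = I(S;X|Y) + I(S;Y|Z), i.e., L_S(X→Z) = L_S(X→Y) + L_S(Y→Z). -/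
open MeasureTheory ProbabilityTheory Finset

theorem entropy_comp_injective {Ω A B : Type*} [MeasurableSpace Ω] [Fintype A] [Fintype B]
    (μ : Measure Ω) (X : Ω → A) (e : A → B) (he : Function.Injective e) :
    entropy μ (fun ω => e (X ω)) = entropy μ X := by
  unfold entropy
  congr 1
  symm
  apply Finset.sum_of_injOn e he.injOn (fun _ _ => by simp)
  · intro b _ hb
    have : (fun ω => e (X ω)) ⁻¹' {b} = ∅ := by
      ext ω
      simp only [Set.mem_preimage, Set.mem_singleton_iff, Set.mem_empty_iff_false, iff_false]
      intro h
      exact hb ⟨X ω, by simp, h⟩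
    simp [this]
  · intro a _
    have : (fun ω => e (X ω)) ⁻¹' {e a} = X ⁻¹' {a} := by
      ext ω
      simp [he.eq_iff]
    rw [this]

/-- Relevant information loss in a cascade is additive: for `Y = g(X)` and
`Z = h(Y)`, `I(S;X|Z) = I(S;X|Y) + I(S;Y|Z)`, i.e.
`L_S(X→Z) = L_S(X→Y) + L_S(Y→Z)`. -/
theorem cascade_relevant_loss_additive
    {Ω A B D C : Type*} [MeasurableSpace Ω]
    [Fintype A] [MeasurableSpace A] [DiscreteMeasurableSpace A]
    [Fintype B] [MeasurableSpace B] [DiscreteMeasurableSpace B]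
    [Fintype D] [MeasurableSpace D] [DiscreteMeasurableSpace D]
    [Fintype C] [MeasurableSpace C] [DiscreteMeasurableSpace C]
    (μ : Measure Ω) [IsProbabilityMeasure μ]
    (X : Ω → A) (S : Ω → C) (g : A → B) (h : B → D)
    (hX : Measurable X) (hS : Measurable S) :
    condMutualInfo μ S X (fun ω => h (g (X ω))) =
      condMutualInfo μ S X (fun ω => g (X ω)) +
        condMutualInfo μ S (fun ω => g (X ω)) (fun ω => h (g (X ω))) := by
  have h1 := entropy_comp_injective μ X (fun a => (a, h (g a)))
    (fun a b hab => (Prod.mk.inj hab).1)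
  have h2 := entropy_comp_injective μ X (fun a => (a, g a))
    (fun a b hab => (Prod.mk.inj hab).1)
  have h3 := entropy_comp_injective μ (fun ω => g (X ω)) (fun a => (a, h a))
    (fun a b hab => (Prod.mk.inj hab).1)
  have h4 := entropy_comp_injective μ (fun ω => (S ω, X ω)) (fun p => (p, h (g p.2)))
    (fun a b hab => (Prod.mk.inj hab).1)
  have h5 := entropy_comp_injective μ (fun ω => (S ω, X ω)) (fun p => (p, g p.2))
    (fun a b hab => (Prod.mk.inj hab).1)
  have h6 := entropy_comp_injective μ (fun ω => (S ω, g (X ω))) (fun p => (p, h p.2))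
    (fun a b hab => (Prod.mk.inj hab).1)
  unfold condMutualInfo condEntropy
  simp only at h1 h2 h3 h4 h5 h6
  rw [h1, h2, h3, h4, h5, h6]
  ring
end

section
/- Let a > 1, let S be uniformly distributed on {−1, 1}, let N be uniformly distributed on [−a, a], with S and N independent, and set X = S + N. Define the ternary quantizer output Y by Y = 1 if X > a−1, Y = −1 if X < −(a−1), and Y = 0 otherwise. Then: (i) S and X are conditionally independent given Y; (ii) P(Y = 0) = (a−1)/a; (iii) on the event {Y = 1} one has S = 1 almost surely, and on {Y = −1} one has S = −1 almost surely. In particular the relevant information loss L_S(X→Y) = I(S;X|Y) vanishes. -/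
open MeasureTheory ProbabilityTheory

lemma tq_key {Ω : Type*} [MeasurableSpace Ω] (μ : Measure Ω)
    (a : ℝ) (S N : Ω → ℝ) (hN : Measurable N)
    (hNdist : Measure.map N μ = (ENNReal.ofReal (2 * a))⁻¹ • volume.restrict (Set.Icc (-a) a))
    (hindep : IndepFun S N μ)
    (X : Ω → ℝ) (hX : ∀ ω, X ω = S ω + N ω) (s : ℝ) (hs : μ {ω | S ω = s} = 1 / 2)
    (B : Set ℝ) (hB : MeasurableSet B) :
    μ ({ω | S ω = s} ∩ X ⁻¹' B) =
      1 / 2 * ((ENNReal.ofReal (2 * a))⁻¹ * volume (B ∩ Set.Icc (s - a) (s + a))) := by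
  have h1 : {ω | S ω = s} ∩ X ⁻¹' B = S ⁻¹' {s} ∩ N ⁻¹' ((fun x => s + x) ⁻¹' B) := by
    ext ω
    simp only [Set.mem_inter_iff, Set.mem_setOf_eq, Set.mem_preimage, Set.mem_singleton_iff, hX]
    constructor
    · rintro ⟨h, h'⟩; exact ⟨h, h ▸ h'⟩
    · rintro ⟨h, h'⟩; exact ⟨h, h.symm ▸ h'⟩
  have hB' : MeasurableSet ((fun x => s + x) ⁻¹' B) := (measurable_const_add s) hB
  rw [h1, hindep.measure_inter_preimage_eq_mul _ _ (measurableSet_singleton s) hB']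
  have h2 : μ (S ⁻¹' {s}) = 1 / 2 := hs
  rw [h2, ← Measure.map_apply hN hB', hNdist, Measure.smul_apply, Measure.restrict_apply hB',
    smul_eq_mul]
  congr 2
  rw [← measure_preimage_add volume s (B ∩ Set.Icc (s - a) (s + a))]
  congr 1
  ext x
  simp only [Set.mem_inter_iff, Set.mem_preimage, Set.mem_Icc]
  constructor
  · rintro ⟨h, h', h''⟩; exact ⟨h, by linarith, by linarith⟩
  · rintro ⟨h, h', h''⟩; exact ⟨h, by linarith, by linarith⟩

lemma tq_split {Ω : Type*} [MeasurableSpace Ω] (ν : Measure Ω)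
    (S : Ω → ℝ) (hS : Measurable S) (hSval : ∀ ω, S ω = 1 ∨ S ω = -1) (T : Set Ω) :
    ν T = ν ({ω | S ω = 1} ∩ T) + ν ({ω | S ω = -1} ∩ T) := by
  have hm : MeasurableSet {ω | S ω = 1} := hS (measurableSet_singleton 1)
  rw [← measure_inter_add_diff T hm, Set.inter_comm]
  congr 2
  ext ω
  simp only [Set.mem_inter_iff, Set.mem_diff, Set.mem_setOf_eq]
  rcases hSval ω with h | h <;> rw [h] <;> norm_num

lemma tq_indep {Ω : Type*} [MeasurableSpace Ω] (ν : Measure Ω) [IsProbabilityMeasure ν]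
    (S X : Ω → ℝ) (hS : Measurable S) (hSval : ∀ ω, S ω = 1 ∨ S ω = -1)
    (h : ∀ B, MeasurableSet B → ν ({ω | S ω = 1} ∩ X ⁻¹' B) = ν ({ω | S ω = -1} ∩ X ⁻¹' B)) :
    IndepFun S X ν := by
  rw [indepFun_iff_measure_inter_preimage_eq_mul]
  intro A B hA hB
  have hu := tq_split ν S hS hSval Set.univ
  have huniv := h Set.univ MeasurableSet.univ
  simp only [Set.preimage_univ, Set.inter_univ, measure_univ] at hu huniv
  have hhalf : ν {ω | S ω = -1} = 2⁻¹ := by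
    rw [huniv, ← two_mul] at hu
    exact ENNReal.eq_inv_of_mul_eq_one_left (by rw [mul_comm]; exact hu.symm)
  have hXB := tq_split ν S hS hSval (X ⁻¹' B)
  rw [h B hB, ← two_mul] at hXB
  have e1 := tq_split ν S hS hSval (S ⁻¹' A ∩ X ⁻¹' B)
  have e2 := tq_split ν S hS hSval (S ⁻¹' A)
  have key : ∀ (s : ℝ) (T : Set Ω), {ω | S ω = s} ∩ (S ⁻¹' A ∩ T) =
      {ω | S ω = s ∧ s ∈ A} ∩ T := by
    intro s T
    ext ω
    simp only [Set.mem_inter_iff, Set.mem_setOf_eq, Set.mem_preimage]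
    constructor
    · rintro ⟨h1, h2, h3⟩; exact ⟨⟨h1, h1 ▸ h2⟩, h3⟩
    · rintro ⟨⟨h1, h2⟩, h3⟩; exact ⟨h1, h1.symm ▸ h2, h3⟩
  have key2 : ∀ (s : ℝ), {ω | S ω = s} ∩ (S ⁻¹' A) = {ω | S ω = s ∧ s ∈ A} := by
    intro s
    have := key s Set.univ
    simpa using this
  rw [key, key] at e1
  rw [key2, key2] at e2
  rw [e1, e2, hXB]
  by_cases h1 : (1 : ℝ) ∈ A <;> by_cases h2 : (-1 : ℝ) ∈ A <;>
    simp [h1, h2, h B hB, hhalf, huniv, ← mul_assoc, ENNReal.inv_mul_cancel,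
      ENNReal.inv_two_add_inv_two, two_mul]
  all_goals rw [← two_mul, ← mul_assoc, ENNReal.inv_mul_cancel (by norm_num) (by norm_num), one_mul]

lemma tq_const {Ω : Type*} [MeasurableSpace Ω] (ν : Measure Ω) [IsProbabilityMeasure ν]
    (S X : Ω → ℝ) (s : ℝ) (h : ν {ω | S ω ≠ s} = 0) : IndepFun S X ν := by
  have h0 : IndepFun (fun _ : Ω => s) X ν := indepFun_const_left s X
  refine h0.congr ?_ (Filter.EventuallyEq.refl _ _)
  have : ∀ᵐ ω ∂ν, S ω = s := h
  filter_upwards [this] with ω hω using hω.symm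

/-- with `S` uniform on `{−1,1}`, `N` uniform on `[−a,a]` (`a > 1`) independent
of `S`, `X = S + N`, and the ternary quantizer output `Y` (`Y = 1` if `X > a−1`, `Y = −1` if
`X < −(a−1)`, `Y = 0` otherwise):
(i) `S` and `X` are conditionally independent given `Y` (independence under each conditional
measure `μ[|{Y = y}]` for every value `y` of positive probability);
(ii) `P(Y = 0) = (a−1)/a`;
(iii) on `{Y = 1}` one has `S = 1` a.s., and on `{Y = −1}` one has `S = −1` a.s.
In particular the relevant information loss `L_S(X→Y) = I(S;X|Y)` vanishes. -/
theorem ternary_quantizer_no_relevant_loss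
    {Ω : Type*} [MeasurableSpace Ω] (μ : Measure Ω) [IsProbabilityMeasure μ]
    (a : ℝ) (ha : 1 < a)
    (S N : Ω → ℝ) (hS : Measurable S) (hN : Measurable N)
    (hSval : ∀ ω, S ω = 1 ∨ S ω = -1)
    (hS1 : μ {ω | S ω = 1} = 1 / 2) (hSm1 : μ {ω | S ω = -1} = 1 / 2)
    (hNdist : Measure.map N μ = (ENNReal.ofReal (2 * a))⁻¹ • volume.restrict (Set.Icc (-a) a))
    (hindep : IndepFun S N μ)
    (X Y : Ω → ℝ) (hX : ∀ ω, X ω = S ω + N ω)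
    (hY : ∀ ω, Y ω = if a - 1 < X ω then 1 else if X ω < -(a - 1) then -1 else 0) :
    (∀ y : ℝ, μ {ω | Y ω = y} ≠ 0 → IndepFun S X (μ[|{ω | Y ω = y}])) ∧
      μ {ω | Y ω = 0} = ENNReal.ofReal ((a - 1) / a) ∧
      μ[|{ω | Y ω = 1}] {ω | S ω = 1} = 1 ∧
      μ[|{ω | Y ω = -1}] {ω | S ω = -1} = 1 := by
  have ha0 : 0 < 2 * a := by linarith
  have hXm : Measurable X := by
    have : X = fun ω => S ω + N ω := funext hX
    rw [this]; exact hS.add hN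
  have k1 := tq_key μ a S N hN hNdist hindep X hX 1 hS1
  have k2 := tq_key μ a S N hN hNdist hindep X hX (-1) hSm1
  have y1 : {ω | Y ω = 1} = X ⁻¹' (Set.Ioi (a - 1)) := by
    ext ω
    simp only [Set.mem_setOf_eq, Set.mem_preimage, Set.mem_Ioi, hY]
    split_ifs <;> norm_num <;> linarith
  have y2 : {ω | Y ω = -1} = X ⁻¹' (Set.Iio (-(a - 1))) := by
    ext ω
    simp only [Set.mem_setOf_eq, Set.mem_preimage, Set.mem_Iio, hY]
    split_ifs <;> norm_num <;> linarith
  have y0 : {ω | Y ω = 0} = X ⁻¹' (Set.Icc (-(a - 1)) (a - 1)) := by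
    ext ω
    simp only [Set.mem_setOf_eq, Set.mem_preimage, Set.mem_Icc, hY]
    split_ifs <;> norm_num <;> (try intro) <;> (try constructor) <;> linarith
  have m1 : MeasurableSet {ω | Y ω = 1} := y1 ▸ hXm measurableSet_Ioi
  have m2 : MeasurableSet {ω | Y ω = -1} := y2 ▸ hXm measurableSet_Iio
  have m0 : MeasurableSet {ω | Y ω = 0} := y0 ▸ hXm measurableSet_Icc
  have hc : (ENNReal.ofReal (2 * a))⁻¹ ≠ 0 := ENNReal.inv_ne_zero.2 ENNReal.ofReal_ne_top
  have n1 : μ {ω | Y ω = 1} ≠ 0 := by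
    intro h
    have h' := measure_mono_null (Set.inter_subset_right (s := {ω | S ω = 1})) h
    rw [y1, k1 _ measurableSet_Ioi] at h'
    have hv : Set.Ioi (a - 1) ∩ Set.Icc (1 - a) (1 + a) = Set.Ioc (a - 1) (1 + a) := by
      ext x; simp only [Set.mem_inter_iff, Set.mem_Ioi, Set.mem_Icc, Set.mem_Ioc]
      constructor
      · rintro ⟨p, q, r⟩; exact ⟨p, r⟩
      · rintro ⟨p, r⟩; exact ⟨p, by linarith, r⟩
    rw [hv, Real.volume_Ioc] at h'
    simp only [mul_eq_zero, hc, false_or, ENNReal.ofReal_eq_zero] at h'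
    rcases h' with h' | h'
    · simp at h'
    · linarith
  have n2 : μ {ω | Y ω = -1} ≠ 0 := by
    intro h
    have h' := measure_mono_null (Set.inter_subset_right (s := {ω | S ω = -1})) h
    rw [y2, k2 _ measurableSet_Iio] at h'
    have hv : Set.Iio (-(a - 1)) ∩ Set.Icc (-1 - a) (-1 + a) = Set.Ico (-1 - a) (-(a - 1)) := by
      ext x; simp only [Set.mem_inter_iff, Set.mem_Iio, Set.mem_Icc, Set.mem_Ico]
      constructor
      · rintro ⟨p, q, r⟩; exact ⟨q, p⟩
      · rintro ⟨p, r⟩; exact ⟨r, p, by linarith⟩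
    rw [hv, Real.volume_Ico] at h'
    simp only [mul_eq_zero, hc, false_or, ENNReal.ofReal_eq_zero] at h'
    rcases h' with h' | h'
    · simp at h'
    · linarith
  have z1 : μ[|{ω | Y ω = 1}] {ω | S ω ≠ 1} = 0 := by
    have hs : {ω | S ω ≠ 1} = {ω | S ω = -1} := by
      ext ω; simp only [Set.mem_setOf_eq]; rcases hSval ω with h | h <;> rw [h] <;> norm_num
    have hv : Set.Ioi (a - 1) ∩ Set.Icc (-1 - a) (-1 + a) = ∅ := by
      ext x; simp only [Set.mem_inter_iff, Set.mem_Ioi, Set.mem_Icc, Set.mem_empty_iff_false,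
        iff_false]
      rintro ⟨p, q, r⟩; linarith
    rw [cond_apply m1, hs, Set.inter_comm, y1, k2 _ measurableSet_Ioi, hv]
    simp
  have z2 : μ[|{ω | Y ω = -1}] {ω | S ω ≠ -1} = 0 := by
    have hs : {ω | S ω ≠ -1} = {ω | S ω = 1} := by
      ext ω; simp only [Set.mem_setOf_eq]; rcases hSval ω with h | h <;> rw [h] <;> norm_num
    have hv : Set.Iio (-(a - 1)) ∩ Set.Icc (1 - a) (1 + a) = ∅ := by
      ext x; simp only [Set.mem_inter_iff, Set.mem_Iio, Set.mem_Icc, Set.mem_empty_iff_false,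
        iff_false]
      rintro ⟨p, q, r⟩; linarith
    rw [cond_apply m2, hs, Set.inter_comm, y2, k1 _ measurableSet_Iio, hv]
    simp
  have i1 : ∀ B : Set ℝ, B ∩ Set.Icc (-(a - 1)) (a - 1) ∩ Set.Icc (1 - a) (1 + a) =
      B ∩ Set.Icc (-(a - 1)) (a - 1) := by
    intro B
    refine Set.inter_eq_left.2 ?_
    rintro x ⟨_, p, q⟩
    exact ⟨by linarith, by linarith⟩
  have i2 : ∀ B : Set ℝ, B ∩ Set.Icc (-(a - 1)) (a - 1) ∩ Set.Icc (-1 - a) (-1 + a) =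
      B ∩ Set.Icc (-(a - 1)) (a - 1) := by
    intro B
    refine Set.inter_eq_left.2 ?_
    rintro x ⟨_, p, q⟩
    exact ⟨by linarith, by linarith⟩
  refine ⟨?_, ?_, ?_, ?_⟩
  · intro y hy
    have : IsProbabilityMeasure (μ[|{ω | Y ω = y}]) := cond_isProbabilityMeasure hy
    by_cases hy1 : y = 1
    · subst hy1; exact tq_const _ S X 1 z1
    by_cases hy2 : y = -1
    · subst hy2; exact tq_const _ S X (-1) z2
    by_cases hy0 : y = 0
    · subst hy0
      refine tq_indep _ S X hS hSval ?_
      intro B hB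
      have e : ∀ s : ℝ, {ω | Y ω = 0} ∩ ({ω | S ω = s} ∩ X ⁻¹' B) =
          {ω | S ω = s} ∩ X ⁻¹' (B ∩ Set.Icc (-(a - 1)) (a - 1)) := by
        intro s
        rw [y0, Set.preimage_inter, Set.inter_comm, Set.inter_assoc]
      rw [cond_apply m0, cond_apply m0, e, e, k1 _ (hB.inter measurableSet_Icc),
        k2 _ (hB.inter measurableSet_Icc), i1, i2]
    · exfalso
      apply hy
      have : {ω | Y ω = y} = ∅ := by
        ext ω
        simp only [Set.mem_setOf_eq, Set.mem_empty_iff_false, iff_false, hY]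
        split_ifs
        · exact fun h => hy1 h.symm
        · exact fun h => hy2 h.symm
        · exact fun h => hy0 h.symm
      rw [this, measure_empty]
  · have j1 := i1 Set.univ
    have j2 := i2 Set.univ
    rw [Set.univ_inter] at j1 j2
    rw [tq_split μ S hS hSval, y0, k1 _ measurableSet_Icc, k2 _ measurableSet_Icc, j1, j2,
      ← add_mul, one_div, ENNReal.inv_two_add_inv_two, one_mul, Real.volume_Icc,
      ← ENNReal.ofReal_inv_of_pos ha0, ← ENNReal.ofReal_mul (by positivity)]
    congr 1
    have : a ≠ 0 := by linarith
    field_simp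
    ring
  · have : IsProbabilityMeasure (μ[|{ω | Y ω = 1}]) := cond_isProbabilityMeasure n1
    exact (prob_compl_eq_zero_iff (hS (measurableSet_singleton 1))).1 z1
  · have : IsProbabilityMeasure (μ[|{ω | Y ω = -1}]) := cond_isProbabilityMeasure n2
    exact (prob_compl_eq_zero_iff (hS (measurableSet_singleton (-1)))).1 z2
end

section
/- Let a > 1, let S be uniformly distributed on {−1, 1}, let N be uniformly distributed on [−a, a], with S and N independent, and set X = S + N. Then the random variable Y' = |X| = |S + N| is independent of S. -/
open MeasureTheory ProbabilityTheory

/-- with `S` uniform on `{−1,1}`, `N` uniform on `[−a,a]` (`a > 1`) independent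
of `S`, and `X = S + N`, the random variable `Y' = |X| = |S + N|` is independent of `S`. -/
theorem abs_output_indep_of_input
    {Ω : Type*} [MeasurableSpace Ω] (μ : Measure Ω) [IsProbabilityMeasure μ]
    (a : ℝ) (ha : 1 < a)
    (S N : Ω → ℝ) (hS : Measurable S) (hN : Measurable N)
    (hSval : ∀ ω, S ω = 1 ∨ S ω = -1)
    (hS1 : μ {ω | S ω = 1} = 1 / 2) (hSm1 : μ {ω | S ω = -1} = 1 / 2)
    (hNdist : Measure.map N μ = (ENNReal.ofReal (2 * a))⁻¹ • volume.restrict (Set.Icc (-a) a))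
    (hindep : IndepFun S N μ) :
    IndepFun S (fun ω => |S ω + N ω|) μ := by
  have key : ∀ A B : Set ℝ, MeasurableSet A → MeasurableSet B →
      μ (S ⁻¹' A ∩ (fun ω => |S ω + N ω|) ⁻¹' B)
        = μ (S ⁻¹' A) * μ (N ⁻¹' {n | |1 + n| ∈ B}) := by
    intro A B hA hB
    have hC : MeasurableSet {n : ℝ | |1 + n| ∈ B} :=
      (by fun_prop : Measurable fun n : ℝ => |1 + n|) hB
    have hD : MeasurableSet {n : ℝ | |-1 + n| ∈ B} :=
      (by fun_prop : Measurable fun n : ℝ => |-1 + n|) hB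
    have hq : μ (N ⁻¹' {n | |-1 + n| ∈ B}) = μ (N ⁻¹' {n | |1 + n| ∈ B}) := by
      rw [← Measure.map_apply hN hD, ← Measure.map_apply hN hC, hNdist]
      simp only [Measure.smul_apply, Measure.restrict_apply hC, Measure.restrict_apply hD]
      congr 1
      rw [← Measure.measure_preimage_neg]
      congr 1
      ext x
      have h : |-1 + -x| = |1 + x| := by rw [← abs_neg]; congr 1; ring
      simp only [Set.mem_preimage, Set.mem_inter_iff, Set.mem_setOf_eq, Set.mem_Icc, h]
      refine and_congr_right fun _ => ⟨fun h => ⟨?_, ?_⟩, fun h => ⟨?_, ?_⟩⟩ <;> linarith [h.1, h.2]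
    have hA1 : MeasurableSet (A ∩ {1}) := hA.inter (measurableSet_singleton _)
    have hA2 : MeasurableSet (A \ {1}) := hA.diff (measurableSet_singleton _)
    have e1 := hindep.measure_inter_preimage_eq_mul _ _ hA1 hC
    have e2 := hindep.measure_inter_preimage_eq_mul _ _ hA2 hD
    have hm : MeasurableSet (S ⁻¹' {1}) := hS (measurableSet_singleton _)
    rw [← measure_inter_add_diff (S ⁻¹' A) hm, ← measure_inter_add_diff _ hm, add_mul]
    rw [hq] at e2
    rw [← Set.preimage_inter, ← Set.preimage_diff, ← e1, ← e2]
    congr 2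
    · ext ω
      simp only [Set.mem_preimage, Set.mem_inter_iff, Set.mem_setOf_eq, Set.mem_singleton_iff]
      constructor
      · rintro ⟨⟨h1, h2⟩, h3⟩
        rw [h3] at h2
        exact ⟨⟨h1, h3⟩, h2⟩
      · rintro ⟨⟨h1, h3⟩, h2⟩
        rw [← h3] at h2
        exact ⟨⟨h1, h2⟩, h3⟩
    · ext ω
      simp only [Set.mem_preimage, Set.mem_inter_iff, Set.mem_diff, Set.mem_setOf_eq,
        Set.mem_singleton_iff]
      rcases hSval ω with h | h
      · simp [h]
      · rw [h]; tauto
  rw [indepFun_iff_measure_inter_preimage_eq_mul]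
  intro A B hA hB
  have h := key Set.univ B MeasurableSet.univ hB
  rw [Set.preimage_univ, Set.univ_inter, measure_univ, one_mul] at h
  rw [key A B hA hB, h]
end

section
/- (Combined eigenvalue inequality underlying the bound on the relevant information loss of PCA.) Let A and B be real symmetric N×N matrices, with A positive semidefinite of rank at most M (1 ≤ M ≤ N) and B positive definite. Let λ₁ ≥ … ≥ λ_N be the eigenvalues of A + B and μ₁ ≥ … ≥ μ_N > 0 the eigenvalues of B. Let W be any real orthogonal N×N matrix and let B̃ be the top-left M×M principal submatrix of WᵀBW, with eigenvalues μ̃₁ ≥ … ≥ μ̃_M. Then (∏_{i=M+1}^{N} λ_i · ∏_{i=1}^{M} μ̃_i) / ∏_{i=1}^{N} μ_i ≤ ∏_{i=M+1}^{N} (μ₁ / μ_i). -/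
open Matrix Finset

/-- Dimension count: a map of rank at most `j` kills a nonzero vector supported on `{0,…,j}`. -/
theorem exists_kernel_vec {n : ℕ} {Y : Type*} [AddCommGroup Y] [Module ℝ Y]
    [FiniteDimensional ℝ Y]
    (D : (Fin n → ℝ) →ₗ[ℝ] Y) (j : Fin n) (hr : Module.finrank ℝ (LinearMap.range D) ≤ j)
    (a : Fin n → ℝ) (ha : Antitone a) :
    ∃ x : Fin n → ℝ, 0 < x ⬝ᵥ x ∧ D x = 0 ∧ a j * (x ⬝ᵥ x) ≤ x ⬝ᵥ (diagonal a *ᵥ x) := by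
  have hj : (j : ℕ) + 1 ≤ n := j.2
  let E : (Fin ((j : ℕ) + 1) → ℝ) →ₗ[ℝ] (Fin n → ℝ) :=
    Function.ExtendByZero.linearMap ℝ (Fin.castLE hj)
  have hk : LinearMap.ker (D.rangeRestrict ∘ₗ E) ≠ ⊥ := by
    apply LinearMap.ker_ne_bot_of_finrank_lt
    simp only [Module.finrank_fintype_fun_eq_card, Fintype.card_fin]
    omega
  obtain ⟨y, hy, hy0⟩ := Submodule.exists_mem_ne_zero_of_ne_bot hk
  have hE : ∀ i, E y (Fin.castLE hj i) = y i := by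
    intro i
    simp only [E, Function.ExtendByZero.linearMap_apply]
    exact (Fin.castLE_injective hj).extend_apply _ _ _
  have hx0 : E y ≠ 0 := by
    intro h
    apply hy0
    ext i
    rw [← hE i, h]; rfl
  refine ⟨E y, ?_, ?_, ?_⟩
  · have h1 : 0 ≤ E y ⬝ᵥ E y := Finset.sum_nonneg fun i _ => mul_self_nonneg _
    exact lt_of_le_of_ne h1 fun h => hx0 (dotProduct_self_eq_zero.1 h.symm)
  · have := LinearMap.mem_ker.1 hy
    simpa [Subtype.ext_iff] using this
  · simp only [dotProduct, mulVec_diagonal, Finset.mul_sum]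
    apply Finset.sum_le_sum
    intro i _
    by_cases hi : i ≤ j
    · nlinarith [ha hi, mul_self_nonneg (E y i)]
    · have : E y i = 0 := by
        simp only [E, Function.ExtendByZero.linearMap_apply]
        apply Function.extend_apply'
        rintro ⟨k, rfl⟩
        apply hi
        rw [Fin.le_def]
        have := k.2
        simp
        omega
      simp [this]

theorem interlace {m n : ℕ} (hnm : n ≤ m) (C : Matrix (Fin m) (Fin n) ℝ) (hC : Cᵀ * C = 1)
    (a : Fin n → ℝ) (ha : Antitone a) (b : Fin m → ℝ) (hb : Antitone b)
    (h : diagonal a = Cᵀ * diagonal b * C) (j : Fin n) : a j ≤ b (Fin.castLE hnm j) := by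
  let R : (Fin m → ℝ) →ₗ[ℝ] (Fin (j : ℕ) → ℝ) :=
    LinearMap.funLeft ℝ ℝ (Fin.castLE (j.2.le.trans hnm))
  obtain ⟨x, hx, hD, hq⟩ := exists_kernel_vec (R ∘ₗ C.mulVecLin) j
    (by simpa using Submodule.finrank_le (LinearMap.range (R ∘ₗ C.mulVecLin))) a ha
  have e1 : (C *ᵥ x) ⬝ᵥ (C *ᵥ x) = x ⬝ᵥ x := by
    rw [dotProduct_mulVec, vecMul_mulVec, hC, vecMul_one]
  have e2 : (C *ᵥ x) ⬝ᵥ (diagonal b *ᵥ (C *ᵥ x)) = x ⬝ᵥ (diagonal a *ᵥ x) := by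
    rw [h, ← mulVec_mulVec, ← mulVec_mulVec, dotProduct_mulVec x, vecMul_transpose]
  have e3 : (C *ᵥ x) ⬝ᵥ (diagonal b *ᵥ (C *ᵥ x)) ≤
      b (Fin.castLE hnm j) * ((C *ᵥ x) ⬝ᵥ (C *ᵥ x)) := by
    simp only [dotProduct, mulVec_diagonal, Finset.mul_sum]
    apply Finset.sum_le_sum
    intro i _
    change _ * (_ * (C *ᵥ x) i) ≤ _ * (_ * (C *ᵥ x) i)
    by_cases hi : (i : ℕ) < j
    · have : (C *ᵥ x) i = 0 := congrFun hD ⟨i, hi⟩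
      simp [this]
    · have : b i ≤ b (Fin.castLE hnm j) := hb (by rw [Fin.le_def]; simpa using hi)
      nlinarith [mul_self_nonneg ((C *ᵥ x) i)]
  rw [e1, e2] at e3
  exact le_of_mul_le_mul_right (hq.trans e3) hx

theorem diag_of {n : ℕ} (U S : Matrix (Fin n) (Fin n) ℝ) (hU : Uᵀ * U = 1) (d : Fin n → ℝ)
    (h : S = U * diagonal d * Uᵀ) : diagonal d = Uᵀ * S * U := by
  calc diagonal d = (Uᵀ * U) * diagonal d * (Uᵀ * U) := by simp [hU]
    _ = _ := by rw [h]; simp only [Matrix.mul_assoc]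

theorem diag_nonneg {n : ℕ} (U S : Matrix (Fin n) (Fin n) ℝ) (hU : Uᵀ * U = 1) (d : Fin n → ℝ)
    (h : S = U * diagonal d * Uᵀ) (hS : S.PosSemidef) (i : Fin n) : 0 ≤ d i := by
  have h1 := hS.conjTranspose_mul_mul_same U
  rw [conjTranspose_eq_transpose_of_trivial, ← diag_of U S hU d h] at h1
  exact (posSemidef_diagonal_iff.1 h1) i

/-- Combined eigenvalue inequality underlying the bound on the relevant
information loss of PCA: with `A` real symmetric positive semidefinite of rank at most `M`
(`1 ≤ M ≤ N`), `B` real symmetric positive definite, `lam` (resp. `mu`) the decreasing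
eigenvalues of `A + B` (resp. `B`), `W` orthogonal, and `muTilde` the decreasing eigenvalues of
the top-left `M×M` principal submatrix of `WᵀBW` (all encoded via diagonalization by
orthogonal matrices), one has
`(∏_{i=M+1}^N λ_i · ∏_{i=1}^M μ̃_i) / ∏_{i=1}^N μ_i ≤ ∏_{i=M+1}^N (μ₁/μ_i)`. -/
theorem combined_eigenvalue_inequality_pca
    (N M : ℕ) (hM : 1 ≤ M) (hMN : M ≤ N)
    (A B : Matrix (Fin N) (Fin N) ℝ)
    (hA : A.PosSemidef) (hArank : A.rank ≤ M) (hB : B.PosDef)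
    (lam mu : Fin N → ℝ) (hlam : Antitone lam) (hmu : Antitone mu)
    (hmu_pos : ∀ i, 0 < mu i)
    (U : Matrix (Fin N) (Fin N) ℝ) (hU : Uᵀ * U = 1)
    (hABdiag : A + B = U * Matrix.diagonal lam * Uᵀ)
    (V : Matrix (Fin N) (Fin N) ℝ) (hV : Vᵀ * V = 1)
    (hBdiag : B = V * Matrix.diagonal mu * Vᵀ)
    (W : Matrix (Fin N) (Fin N) ℝ) (hW : Wᵀ * W = 1)
    (Btilde : Matrix (Fin M) (Fin M) ℝ)
    (hBtilde : Btilde = (Wᵀ * B * W).submatrix (Fin.castLE hMN) (Fin.castLE hMN))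
    (muTilde : Fin M → ℝ) (hmut : Antitone muTilde)
    (Q : Matrix (Fin M) (Fin M) ℝ) (hQ : Qᵀ * Q = 1)
    (hBtildediag : Btilde = Q * Matrix.diagonal muTilde * Qᵀ) :
    (∏ i ∈ Finset.univ.filter (fun i : Fin N => M ≤ (i : ℕ)), lam i) *
        (∏ i : Fin M, muTilde i) / (∏ i : Fin N, mu i) ≤
      ∏ i ∈ Finset.univ.filter (fun i : Fin N => M ≤ (i : ℕ)),
        (mu ⟨0, lt_of_lt_of_le hM hMN⟩ / mu i) := by
  have hU' : U * Uᵀ = 1 := mul_eq_one_comm.1 hU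
  have hV' : V * Vᵀ = 1 := mul_eq_one_comm.1 hV
  have hlam0 : ∀ i, 0 ≤ lam i :=
    diag_nonneg U _ hU lam hABdiag (hA.add hB.posSemidef)
  have hBt : Btilde.PosSemidef := by
    rw [hBtilde]
    have := hB.posSemidef.conjTranspose_mul_mul_same W
    rw [conjTranspose_eq_transpose_of_trivial] at this
    exact this.submatrix _
  have hmut0 : ∀ i, 0 ≤ muTilde i := diag_nonneg Q _ hQ muTilde hBtildediag hBt
  have hinter : ∀ j, muTilde j ≤ mu (Fin.castLE hMN j) := by
    let P : Matrix (Fin N) (Fin M) ℝ := (1 : Matrix (Fin N) (Fin N) ℝ).submatrix id (Fin.castLE hMN)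
    have hPs : ∀ X : Matrix (Fin N) (Fin N) ℝ,
        Pᵀ * X * P = X.submatrix (Fin.castLE hMN) (Fin.castLE hMN) := by
      intro X
      ext i j
      simp [P, Matrix.mul_apply, Matrix.one_apply]
    have hPP : Pᵀ * P = 1 := by
      have := hPs 1
      rw [Matrix.mul_one] at this
      rw [this, submatrix_one _ (Fin.castLE_injective hMN)]
    apply interlace hMN (Vᵀ * (W * (P * Q))) _ muTilde hmut mu hmu
    · rw [diag_of Q _ hQ muTilde hBtildediag, hBtilde, ← hPs, hBdiag]
      simp only [transpose_mul, transpose_transpose, Matrix.mul_assoc]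
    · calc _ = Qᵀ * (Pᵀ * (Wᵀ * (V * Vᵀ) * W) * P) * Q := by
            simp only [transpose_mul, transpose_transpose, Matrix.mul_assoc]
        _ = 1 := by rw [hV', Matrix.mul_one, hW, Matrix.mul_one, hPP, Matrix.mul_one, hQ]
  have hweyl : ∀ i : Fin N, M ≤ (i : ℕ) → lam i ≤ mu ⟨0, lt_of_lt_of_le hM hMN⟩ := by
    intro i hi
    obtain ⟨x, hx, hD, hq⟩ := exists_kernel_vec (A * U).mulVecLin i
      ((rank_mul_le_left A U).trans (hArank.trans hi)) lam hlam
    have hAx : A *ᵥ (U *ᵥ x) = 0 := by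
      rw [mulVec_mulVec]; exact hD
    have e0 : x ⬝ᵥ (diagonal lam *ᵥ x) =
        (Vᵀ *ᵥ (U *ᵥ x)) ⬝ᵥ (diagonal mu *ᵥ (Vᵀ *ᵥ (U *ᵥ x))) := by
      rw [diag_of U _ hU lam hABdiag, ← mulVec_mulVec, ← mulVec_mulVec, add_mulVec, hAx,
        zero_add, hBdiag, dotProduct_mulVec, vecMul_transpose, ← mulVec_mulVec, ← mulVec_mulVec,
        dotProduct_mulVec, ← mulVec_transpose]
    have e1 : (Vᵀ *ᵥ (U *ᵥ x)) ⬝ᵥ (Vᵀ *ᵥ (U *ᵥ x)) = x ⬝ᵥ x := by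
      rw [dotProduct_mulVec, vecMul_mulVec, transpose_transpose, hV', vecMul_one,
        dotProduct_mulVec, vecMul_mulVec, hU, vecMul_one]
    have e3 : (Vᵀ *ᵥ (U *ᵥ x)) ⬝ᵥ (diagonal mu *ᵥ (Vᵀ *ᵥ (U *ᵥ x))) ≤
        mu ⟨0, lt_of_lt_of_le hM hMN⟩ * ((Vᵀ *ᵥ (U *ᵥ x)) ⬝ᵥ (Vᵀ *ᵥ (U *ᵥ x))) := by
      generalize Vᵀ *ᵥ (U *ᵥ x) = z
      simp only [dotProduct, mulVec_diagonal, Finset.mul_sum]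
      apply Finset.sum_le_sum
      intro k _
      have : mu k ≤ mu ⟨0, lt_of_lt_of_le hM hMN⟩ := hmu (by rw [Fin.le_def]; exact Nat.zero_le _)
      nlinarith [mul_self_nonneg (z k)]
    rw [e1, ← e0] at e3
    exact le_of_mul_le_mul_right (hq.trans e3) hx
  have hsplit : ∏ i : Fin N, mu i =
      (∏ i ∈ Finset.univ.filter (fun i : Fin N => M ≤ (i : ℕ)), mu i) *
        ∏ i : Fin M, mu (Fin.castLE hMN i) := by
    rw [← Finset.prod_filter_mul_prod_filter_not Finset.univ (fun i : Fin N => M ≤ (i : ℕ))]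
    congr 1
    symm
    apply Finset.prod_bij (fun i _ => Fin.castLE hMN i)
    · intro i _; simp
    · intro i _ k _ h; exact Fin.castLE_injective hMN h
    · intro k hk
      have hk' : (k : ℕ) < M := by simpa using hk
      exact ⟨⟨k, hk'⟩, Finset.mem_univ _, rfl⟩
    · intro i _; rfl
  have hp1 : 0 < ∏ i ∈ Finset.univ.filter (fun i : Fin N => M ≤ (i : ℕ)), mu i :=
    Finset.prod_pos fun i _ => hmu_pos i
  have hp2 : 0 < ∏ i : Fin M, mu (Fin.castLE hMN i) := Finset.prod_pos fun i _ => hmu_pos _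
  have hl : (∏ i ∈ Finset.univ.filter (fun i : Fin N => M ≤ (i : ℕ)), lam i) ≤
      ∏ i ∈ Finset.univ.filter (fun i : Fin N => M ≤ (i : ℕ)),
        mu ⟨0, lt_of_lt_of_le hM hMN⟩ :=
    Finset.prod_le_prod (fun i _ => hlam0 i) fun i hi => hweyl i (by simpa using hi)
  have ht : ∏ i : Fin M, muTilde i ≤ ∏ i : Fin M, mu (Fin.castLE hMN i) :=
    Finset.prod_le_prod (fun i _ => hmut0 i) fun i _ => hinter i
  rw [Finset.prod_div_distrib, hsplit, ← mul_div_mul_right (∏ i ∈ Finset.univ.filter (fun i : Fin N => M ≤ (i : ℕ)), mu ⟨0, _⟩) _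
      hp2.ne']
  refine div_le_div_of_nonneg_right ?_ (mul_pos hp1 hp2).le
  exact mul_le_mul hl ht (Finset.prod_nonneg fun i _ => hmut0 i)
    (Finset.prod_nonneg fun i _ => (hmu_pos _).le)
end
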